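/- Let d ≥ 1 and m ≥ 2d+2 be integers and let 𝒯, 𝒯' be triangulations of the cyclic polytope C(m, 2d+1). Then 𝒯 ≤₂ 𝒯' if and only if every d-face of 𝒯' is a d-face of 𝒯. -/

import Mathlib

open Finset

noncomputable section

/-- The moment curve `p_δ(t) = (t, t², …, t^δ)` in `ℝ^δ`. -/
def momCurve (δ : ℕ) (t : ℝ) : Fin δ → ℝ := fun i => t ^ (i.1 + 1)

/-- The points `p_δ(a)` on the moment curve for `a` ranging over a finite set of naturals. -/
def momPts (δ : ℕ) (A : Finset ℕ) : Set (Fin δ → ℝ) :=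
  (fun a : ℕ => momCurve δ (a : ℝ)) '' (A : Set ℕ)

/-- The simplex `|A|_δ`, i.e. the convex hull of the points `p_δ(a)`, `a ∈ A`. -/
def smp (δ : ℕ) (A : Finset ℕ) : Set (Fin δ → ℝ) := convexHull ℝ (momPts δ A)

/-- The cyclic polytope `C(m, δ) = conv{p_δ(1), …, p_δ(m)}`. -/
def cyc (m δ : ℕ) : Set (Fin δ → ℝ) := smp δ (Finset.Icc 1 m)

/-- The last standard basis vector `e_δ` of `ℝ^δ`. -/
def eLast (δ : ℕ) : Fin δ → ℝ := fun i => if i.1 = δ - 1 then 1 else 0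

/-- The last coordinate of a point of `ℝ^δ`. -/
def lastCoord {δ : ℕ} (x : Fin δ → ℝ) : ℝ :=
  if h : 0 < δ then x ⟨δ - 1, Nat.sub_lt h one_pos⟩ else 0

/-- `x` lies strictly above `V`: `x - r • e_δ ∈ V` for some `r > 0`. -/
def StrictlyAbove {δ : ℕ} (x : Fin δ → ℝ) (V : Set (Fin δ → ℝ)) : Prop :=
  ∃ r : ℝ, 0 < r ∧ x - r • eLast δ ∈ V

/-- `x` lies strictly below `V`: `x - r • e_δ ∈ V` for some `r < 0`. -/
def StrictlyBelow {δ : ℕ} (x : Fin δ → ℝ) (V : Set (Fin δ → ℝ)) : Prop :=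
  ∃ r : ℝ, r < 0 ∧ x - r • eLast δ ∈ V

/-- `|F|_δ` is a lower facet of the cyclic polytope `C(m, δ)`. -/
def IsLowerFacet (m δ : ℕ) (F : Finset ℕ) : Prop :=
  F ⊆ Finset.Icc 1 m ∧ F.card = δ ∧
    ∀ i ∈ Finset.Icc 1 m, i ∉ F →
      StrictlyAbove (momCurve δ (i : ℝ))
        ((affineSpan ℝ (momPts δ F) : AffineSubspace ℝ (Fin δ → ℝ)) : Set (Fin δ → ℝ))

/-- `|F|_δ` is an upper facet of the cyclic polytope `C(m, δ)`. -/
def IsUpperFacet (m δ : ℕ) (F : Finset ℕ) : Prop :=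
  F ⊆ Finset.Icc 1 m ∧ F.card = δ ∧
    ∀ i ∈ Finset.Icc 1 m, i ∉ F →
      StrictlyBelow (momCurve δ (i : ℝ))
        ((affineSpan ℝ (momPts δ F) : AffineSubspace ℝ (Fin δ → ℝ)) : Set (Fin δ → ℝ))

/-- The facet `|H ∖ {c}|_δ` of the simplex `|H|_δ` is a lower facet of `|H|_δ`. -/
def IsLowerFacetOfSimplex (δ : ℕ) (H : Finset ℕ) (c : ℕ) : Prop :=
  c ∈ H ∧ StrictlyAbove (momCurve δ (c : ℝ))
    ((affineSpan ℝ (momPts δ (H.erase c)) : AffineSubspace ℝ (Fin δ → ℝ)) : Set (Fin δ → ℝ))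

/-- The facet `|H ∖ {c}|_δ` of the simplex `|H|_δ` is an upper facet of `|H|_δ`. -/
def IsUpperFacetOfSimplex (δ : ℕ) (H : Finset ℕ) (c : ℕ) : Prop :=
  c ∈ H ∧ StrictlyBelow (momCurve δ (c : ℝ))
    ((affineSpan ℝ (momPts δ (H.erase c)) : AffineSubspace ℝ (Fin δ → ℝ)) : Set (Fin δ → ℝ))

/-- `T` is a triangulation of the cyclic polytope `C(m, δ)`. -/
def IsTriangulation (m δ : ℕ) (T : Finset (Finset ℕ)) : Prop :=
  (∀ S ∈ T, S ⊆ Finset.Icc 1 m ∧ S.card = δ + 1) ∧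
  (⋃ S ∈ T, smp δ S) = cyc m δ ∧
  ∀ S ∈ T, ∀ S' ∈ T, smp δ S ∩ smp δ S' = smp δ (S ∩ S')

/-- `A` is a face of the triangulation `T`. -/
def IsFace (T : Finset (Finset ℕ)) (A : Finset ℕ) : Prop := ∃ S ∈ T, A ⊆ S

/-- `A ≀ B`: writing `A = {a_0 < … < a_d}` and `B = {b_0 < … < b_d}`, we have
`a_0 < b_0 < a_1 < b_1 < … < a_d < b_d`. -/
def Intertwines (d : ℕ) (A B : Finset ℕ) : Prop :=
  ∃ a b : Fin (d + 1) → ℕ, StrictMono a ∧ StrictMono b ∧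
    A = Finset.image a Finset.univ ∧ B = Finset.image b Finset.univ ∧
    (∀ i, a i < b i) ∧ ∀ i : Fin d, b i.castSucc < a i.succ

/-- `y = ℓ_S(x)` is the lift of `x ∈ |S|_δ` to `ℝ^{δ+1}` given by the barycentric
coordinates of `x` with respect to the vertices of `|S|_δ`. -/
def IsLift (δ : ℕ) (S : Finset ℕ) (x : Fin δ → ℝ) (y : Fin (δ + 1) → ℝ) : Prop :=
  ∃ w : ℕ → ℝ, (∀ a ∈ S, 0 ≤ w a) ∧ (∑ a ∈ S, w a) = 1 ∧
    (∑ a ∈ S, w a • momCurve δ (a : ℝ)) = x ∧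
    (∑ a ∈ S, w a • momCurve (δ + 1) (a : ℝ)) = y

/-- `|A|_δ` is submerged by the triangulation `T`. -/
def Submerged (δ : ℕ) (T : Finset (Finset ℕ)) (A : Finset ℕ) : Prop :=
  ∀ S ∈ T, ∀ x ∈ smp δ A ∩ smp δ S, ∀ y y' : Fin (δ + 1) → ℝ,
    IsLift δ A x y → IsLift δ S x y' → lastCoord y ≤ lastCoord y'

/-- `|A|_δ` is supermerged by the triangulation `T`. -/
def Supermerged (δ : ℕ) (T : Finset (Finset ℕ)) (A : Finset ℕ) : Prop :=
  ∀ S ∈ T, ∀ x ∈ smp δ A ∩ smp δ S, ∀ y y' : Fin (δ + 1) → ℝ,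
    IsLift δ A x y → IsLift δ S x y' → lastCoord y' ≤ lastCoord y

/-- The second higher Stasheff–Tamari order `T ≤₂ T'`. -/
def HST2 (δ : ℕ) (T T' : Finset (Finset ℕ)) : Prop :=
  ∀ S ∈ T, ∀ S' ∈ T', ∀ x ∈ smp δ S ∩ smp δ S', ∀ y y' : Fin (δ + 1) → ℝ,
    IsLift δ S x y → IsLift δ S' x y' → lastCoord y ≤ lastCoord y'

open scoped Classical in
/-- The lower triangulation of `C(m, δ)`: the collection of `(δ+1)`-element subsets `F` of
`{1, …, m}` such that `|F|_{δ+1}` is a lower facet of `C(m, δ+1)`. -/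
def lowerTriang (m δ : ℕ) : Finset (Finset ℕ) :=
  (Finset.Icc 1 m).powerset.filter (fun F => IsLowerFacet m (δ + 1) F)

open scoped Classical in
/-- The upper triangulation of `C(m, δ)`. -/
def upperTriang (m δ : ℕ) : Finset (Finset ℕ) :=
  (Finset.Icc 1 m).powerset.filter (fun F => IsUpperFacet m (δ + 1) F)

open scoped Classical in
/-- `L(H)`: the `(δ+1)`-element subsets `G` of `H` with `|G|_{δ+1}` a lower facet of the
simplex `|H|_{δ+1}`. -/
def LH (δ : ℕ) (H : Finset ℕ) : Finset (Finset ℕ) :=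
  (H.filter (fun c => IsLowerFacetOfSimplex (δ + 1) H c)).image (fun c => H.erase c)

open scoped Classical in
/-- `U(H)`: the `(δ+1)`-element subsets `G` of `H` with `|G|_{δ+1}` an upper facet of the
simplex `|H|_{δ+1}`. -/
def UH (δ : ℕ) (H : Finset ℕ) : Finset (Finset ℕ) :=
  (H.filter (fun c => IsUpperFacetOfSimplex (δ + 1) H c)).image (fun c => H.erase c)

open Polynomial in
/-- A signed measure on `E` whose moments of order `< n` vanish annihilates the polynomials of
degree `< n`. -/
lemma sum_mul_eval_eq_zero {E : Finset ℕ} {u : ℕ → ℝ} {n : ℕ}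
    (hu : ∀ k < n, ∑ a ∈ E, u a * (a : ℝ) ^ k = 0) {p : ℝ[X]} (hp : p.degree < n) :
    ∑ a ∈ E, u a * p.eval (a : ℝ) = 0 := by
  rcases eq_or_ne p 0 with rfl | h0
  · simp
  have hn : p.natDegree < n := (Polynomial.natDegree_lt_iff_degree_lt h0).2 hp
  simp_rw [Polynomial.eval_eq_sum_range, Finset.mul_sum]
  rw [Finset.sum_comm]
  refine Finset.sum_eq_zero fun k hk => ?_
  have hk' : k < n := by rw [Finset.mem_range] at hk; omega
  calc ∑ a ∈ E, u a * (p.coeff k * (a : ℝ) ^ k)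
      = p.coeff k * ∑ a ∈ E, u a * (a : ℝ) ^ k := by
        rw [Finset.mul_sum]
        exact Finset.sum_congr rfl fun a _ => by ring
    _ = 0 := by rw [hu k hk', mul_zero]

open Polynomial in
/-- If the moments of order `< n` vanish, then integrating a monic polynomial of degree `n`
gives the moment of order `n`. -/
lemma sum_mul_eval_eq_of_monic {E : Finset ℕ} {u : ℕ → ℝ} {n : ℕ}
    (hu : ∀ k < n, ∑ a ∈ E, u a * (a : ℝ) ^ k = 0) {p : ℝ[X]} (hp : p.Monic)
    (hn : p.natDegree = n) :
    ∑ a ∈ E, u a * p.eval (a : ℝ) = ∑ a ∈ E, u a * (a : ℝ) ^ n := by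
  have hdeg : (p - X ^ n).degree < (n : WithBot ℕ) := by
    have h1 : p.degree = n := by rw [Polynomial.degree_eq_natDegree hp.ne_zero, hn]
    have h2 : (p - X ^ n).degree < p.degree :=
      Polynomial.degree_sub_lt_left (by rw [h1, Polynomial.degree_X_pow]) hp.ne_zero
        (by rw [hp.leadingCoeff, (Polynomial.monic_X_pow n).leadingCoeff])
    rwa [h1] at h2
  have h := sum_mul_eval_eq_zero hu hdeg
  simp only [Polynomial.eval_sub, Polynomial.eval_pow, Polynomial.eval_X, mul_sub,
    Finset.sum_sub_distrib] at h
  linarith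

open Polynomial in
/-- A signed measure supported on at most `n` points whose moments of order `< n` vanish is
zero. -/
lemma eq_zero_of_moments_eq_zero {E : Finset ℕ} {u : ℕ → ℝ} {n : ℕ}
    (hu : ∀ k < n, ∑ a ∈ E, u a * (a : ℝ) ^ k = 0) {F : Finset ℕ} (hF : F.card ≤ n)
    (hsupp : ∀ a ∈ E, u a ≠ 0 → a ∈ F) : ∀ a ∈ E, u a = 0 := by
  intro a ha
  by_contra h0
  have haF := hsupp a ha h0
  have hdeg : (∏ b ∈ F.erase a, (X - C (b : ℝ))).degree < (n : WithBot ℕ) := by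
    rw [Polynomial.degree_prod]
    simp only [Polynomial.degree_X_sub_C, Finset.sum_const, Finset.card_erase_of_mem haF,
      nsmul_eq_mul, mul_one]
    have := Finset.card_pos.2 ⟨a, haF⟩
    exact_mod_cast (by omega : F.card - 1 < n)
  have h := sum_mul_eval_eq_zero hu hdeg
  rw [Finset.sum_eq_single_of_mem a ha] at h
  · rcases mul_eq_zero.1 h with h | h
    · exact h0 h
    · simp only [Polynomial.eval_prod, Polynomial.eval_sub, Polynomial.eval_X,
        Polynomial.eval_C, Finset.prod_eq_zero_iff, Finset.mem_erase] at h
      obtain ⟨b, ⟨hba, -⟩, hb⟩ := h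
      exact hba (by exact_mod_cast (sub_eq_zero.1 hb).symm)
  · intro b hb hba
    by_cases hub : u b = 0
    · rw [hub, zero_mul]
    · rw [Polynomial.eval_prod,
        Finset.prod_eq_zero (Finset.mem_erase.2 ⟨hba, hsupp b hb hub⟩) (by simp), mul_zero]

open Polynomial in
/-- If the moments of order `< 2 * #A` vanish, then the moment of order `2 * #A` is the integral
of the nonnegative function `t ↦ ∏ b ∈ A, (t - b) ^ 2`. -/
lemma sum_mul_prod_sq_eq {E : Finset ℕ} {u : ℕ → ℝ} (A : Finset ℕ)
    (hu : ∀ k < 2 * A.card, ∑ a ∈ E, u a * (a : ℝ) ^ k = 0) :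
    ∑ a ∈ E, u a * ∏ b ∈ A, ((a : ℝ) - b) ^ 2 = ∑ a ∈ E, u a * (a : ℝ) ^ (2 * A.card) := by
  have hm : ∀ b ∈ A, ((X - C (b : ℝ)) ^ 2).Monic := fun b _ =>
    (Polynomial.monic_X_sub_C _).pow 2
  rw [← sum_mul_eval_eq_of_monic hu (Polynomial.monic_prod_of_monic A _ hm)]
  · simp [Polynomial.eval_prod]
  · rw [Polynomial.natDegree_prod_of_monic A _ hm]
    simp only [Polynomial.natDegree_pow, Polynomial.natDegree_X_sub_C, Finset.sum_const,
      smul_eq_mul]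
    ring

/-- More than `n` points carry a nonzero signed measure whose moments of order `< n` vanish. -/
lemma exists_moments_eq_zero {n : ℕ} {F : Finset ℕ} (hF : n < F.card) :
    ∃ z : ℕ → ℝ, (∀ a ∉ F, z a = 0) ∧ (∃ a ∈ F, z a ≠ 0) ∧
      ∀ k < n, ∑ a ∈ F, z a * (a : ℝ) ^ k = 0 := by
  have hker : LinearMap.ker
      (Matrix.of fun (k : Fin n) (a : F) => ((a : ℕ) : ℝ) ^ k.1).mulVecLin ≠ ⊥ :=
    LinearMap.ker_ne_bot_of_finrank_lt (by simpa using hF)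
  obtain ⟨z, hz, hz0⟩ := (Submodule.ne_bot_iff _).1 hker
  obtain ⟨a, ha⟩ := Function.ne_iff.1 hz0
  refine ⟨fun a => if h : a ∈ F then z ⟨a, h⟩ else 0, fun a ha => by simp [ha],
    ⟨a, a.2, by simpa using ha⟩, fun k hk => ?_⟩
  have h := congrFun (LinearMap.mem_ker.1 hz) ⟨k, hk⟩
  simp only [Matrix.mulVecLin_apply, Matrix.mulVec, dotProduct, Matrix.of_apply,
    Pi.zero_apply] at h
  rw [← h, ← Finset.sum_coe_sort F]
  exact Finset.sum_congr rfl fun b _ => by simp [mul_comm]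

/-- Reduction step: a signed measure `u` can be moved along `-z` until it loses a point of its
support, without changing signs. -/
lemma exists_conformal_sub {E : Finset ℕ} {u z : ℕ → ℝ} (hE : ∀ a, u a ≠ 0 → a ∈ E)
    (hz : ∀ a, u a = 0 → z a = 0) (h : ∃ a, 0 < z a * u a) :
    ∃ t : ℝ, 0 ≤ t ∧ (∀ a, 0 < u a - t * z a → 0 < u a) ∧
      (∀ a, u a - t * z a < 0 → u a < 0) ∧ ∃ a, u a ≠ 0 ∧ u a - t * z a = 0 := by
  have hE' : ∀ a, 0 < z a * u a → a ∈ E := fun a h => hE a (by rintro h0; simp [h0] at h)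
  obtain ⟨a₀, hp₀⟩ := h
  obtain ⟨b, hb, hmin⟩ := (E.filter fun a => 0 < z a * u a).exists_min_image
    (fun a => u a / z a) ⟨a₀, Finset.mem_filter.2 ⟨hE' a₀ hp₀, hp₀⟩⟩
  obtain ⟨-, hb⟩ := Finset.mem_filter.1 hb
  have hzb : z b ≠ 0 := by rintro h; simp [h] at hb
  have hub : u b ≠ 0 := by rintro h; simp [h] at hb
  have ht : 0 < u b / z b := by
    have : u b / z b = (z b * u b) / (z b) ^ 2 := by field_simp
    rw [this]; positivity
  have key : ∀ a, 0 < z a * u a → u b / z b ≤ u a / z a := fun a hp =>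
    hmin a (Finset.mem_filter.2 ⟨hE' a hp, hp⟩)
  refine ⟨u b / z b, ht.le, ?_, ?_, b, hub, by field_simp; simp⟩
  · intro a h
    rcases lt_trichotomy (u a) 0 with hu | hu | hu
    · exfalso
      rcases lt_or_ge (z a) 0 with hza | hza
      · have := key a (mul_pos_of_neg_of_neg hza hu)
        rw [le_div_iff_of_neg hza] at this
        linarith
      · have := mul_nonneg ht.le hza
        linarith
    · simp [hu, hz a hu] at h
    · exact hu
  · intro a h
    rcases lt_trichotomy (u a) 0 with hu | hu | hu
    · exact hu
    · simp [hu, hz a hu] at h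
    · exfalso
      rcases lt_or_ge 0 (z a) with hza | hza
      · have := key a (mul_pos hza hu)
        rw [le_div_iff₀ hza] at this
        linarith
      · have := mul_nonpos_of_nonneg_of_nonpos ht.le hza
        linarith

/-- Barycentric description of `|A|_δ`. -/
lemma mem_smp_iff {δ : ℕ} {A : Finset ℕ} {x : Fin δ → ℝ} :
    x ∈ smp δ A ↔ ∃ w : ℕ → ℝ, (∀ a ∈ A, 0 ≤ w a) ∧ (∑ a ∈ A, w a) = 1 ∧
      (∑ a ∈ A, w a • momCurve δ (a : ℝ)) = x := by
  constructor
  · intro hx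
    refine convexHull_min (t := {x | ∃ w : ℕ → ℝ, (∀ a ∈ A, 0 ≤ w a) ∧ (∑ a ∈ A, w a) = 1 ∧
      (∑ a ∈ A, w a • momCurve δ (a : ℝ)) = x}) ?_ ?_ hx
    · rintro _ ⟨b, hb, rfl⟩
      have hb' : b ∈ A := hb
      exact ⟨fun a => if a = b then 1 else 0, fun a _ => by positivity, by simp [hb'],
        by simp [ite_smul, hb']⟩
    · rintro x ⟨w, hw, hw1, rfl⟩ y ⟨w', hw', hw1', rfl⟩ s t hs ht hst
      refine ⟨fun a => s * w a + t * w' a, fun a ha => ?_, ?_, ?_⟩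
      · have := hw a ha
        have := hw' a ha
        positivity
      · rw [Finset.sum_add_distrib, ← Finset.mul_sum, ← Finset.mul_sum, hw1, hw1']
        simpa using hst
      · simp only [add_smul, mul_smul, Finset.sum_add_distrib, Finset.smul_sum]
  · rintro ⟨w, hw, hw1, rfl⟩
    exact (convex_convexHull ℝ _).sum_mem hw hw1 fun a ha =>
      subset_convexHull ℝ _ ⟨a, ha, rfl⟩

lemma smp_mono {δ : ℕ} {A B : Finset ℕ} (h : A ⊆ B) : smp δ A ⊆ smp δ B :=
  convexHull_mono (Set.image_mono (Finset.coe_subset.2 h))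

lemma sum_sub_ite_mul (S S' : Finset ℕ) (w w' f : ℕ → ℝ) :
    ∑ a ∈ S ∪ S', ((if a ∈ S then w a else 0) - (if a ∈ S' then w' a else 0)) * f a =
      ∑ a ∈ S, w a * f a - ∑ a ∈ S', w' a * f a := by
  simp only [sub_mul, ite_mul, zero_mul, Finset.sum_sub_distrib, Finset.sum_ite_mem]
  rw [Finset.inter_eq_right.2 Finset.subset_union_left,
    Finset.inter_eq_right.2 Finset.subset_union_right]

/-- Equality of two points given in barycentric coordinates, as equality of moments. -/
lemma sum_smul_momCurve_eq_iff {δ : ℕ} {S S' : Finset ℕ} {w w' : ℕ → ℝ} :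
    ((∑ a ∈ S, w a) = ∑ a ∈ S', w' a ∧
      (∑ a ∈ S, w a • momCurve δ (a : ℝ)) = ∑ a ∈ S', w' a • momCurve δ (a : ℝ)) ↔
    ∀ k < δ + 1, ∑ a ∈ S, w a * (a : ℝ) ^ k = ∑ a ∈ S', w' a * (a : ℝ) ^ k := by
  constructor
  · rintro ⟨h0, h⟩ k hk
    rcases k with _ | k
    · simpa using h0
    · simpa [momCurve, Finset.sum_apply] using congrFun h ⟨k, by omega⟩
  · intro h
    refine ⟨by simpa using h 0 (by omega), funext fun i => ?_⟩
    simpa [momCurve, Finset.sum_apply] using h (i.1 + 1) (by omega)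

/-- Barycentric coordinates are unique on at most `δ + 1` points of the moment curve. -/
lemma barycentric_unique {δ : ℕ} {S S' F : Finset ℕ} {w w' : ℕ → ℝ} (hS : S ⊆ F) (hS' : S' ⊆ F)
    (hF : F.card ≤ δ + 1)
    (h : ∀ k < δ + 1, ∑ a ∈ S, w a * (a : ℝ) ^ k = ∑ a ∈ S', w' a * (a : ℝ) ^ k) (a : ℕ) :
    (if a ∈ S then w a else 0) = if a ∈ S' then w' a else 0 := by
  by_cases ha : a ∈ S ∪ S'
  · refine sub_eq_zero.1 (eq_zero_of_moments_eq_zero (E := S ∪ S') (F := F) (n := δ + 1)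
      (u := fun a => (if a ∈ S then w a else 0) - if a ∈ S' then w' a else 0)
      (fun k hk => ?_) hF (fun b hb _ => Finset.union_subset hS hS' hb) a ha)
    rw [sum_sub_ite_mul, h k hk, sub_self]
  · rw [Finset.mem_union, not_or] at ha
    rw [if_neg ha.1, if_neg ha.2]

/-- A point has the same barycentric coordinates in all simplices of a triangulation which
contain it. -/
lemma IsTriangulation.barycentric_unique {m δ : ℕ} {T : Finset (Finset ℕ)}
    (hT : IsTriangulation m δ T) {S S' : Finset ℕ} (hS : S ∈ T) (hS' : S' ∈ T) {w w' : ℕ → ℝ}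
    (hw : ∀ a ∈ S, 0 ≤ w a) (hw' : ∀ a ∈ S', 0 ≤ w' a) (hw1 : ∑ a ∈ S, w a = 1)
    (h : ∀ k < δ + 1, ∑ a ∈ S, w a * (a : ℝ) ^ k = ∑ a ∈ S', w' a * (a : ℝ) ^ k) (a : ℕ) :
    (if a ∈ S then w a else 0) = if a ∈ S' then w' a else 0 := by
  obtain ⟨h1, hx⟩ := sum_smul_momCurve_eq_iff.2 h
  have hmem : (∑ a ∈ S, w a • momCurve δ (a : ℝ)) ∈ smp δ S ∩ smp δ S' :=
    ⟨mem_smp_iff.2 ⟨w, hw, hw1, rfl⟩, mem_smp_iff.2 ⟨w', hw', by rw [← h1, hw1], hx.symm⟩⟩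
  rw [hT.2.2 S hS S' hS'] at hmem
  obtain ⟨v, -, hv1, hv⟩ := mem_smp_iff.1 hmem
  have hv' := sum_smul_momCurve_eq_iff.1 ⟨hw1.trans hv1.symm, hv.symm⟩
  rw [_root_.barycentric_unique (Finset.Subset.refl S) Finset.inter_subset_left
    (hT.1 S hS).2.le hv' a]
  exact _root_.barycentric_unique Finset.inter_subset_right (Finset.Subset.refl S')
    (hT.1 S' hS').2.le (fun k hk => (hv' k hk).symm.trans (h k hk)) a

/-- A signed measure with vanishing moments of order `≤ δ` is zero if its positive and negative
parts are both carried by simplices of a triangulation. -/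
lemma IsTriangulation.eq_zero_of_moments_eq_zero {m δ : ℕ} {T : Finset (Finset ℕ)}
    (hT : IsTriangulation m δ T) {S S' E : Finset ℕ} (hS : S ∈ T) (hS' : S' ∈ T) {u : ℕ → ℝ}
    (hE : ∀ a, u a ≠ 0 → a ∈ E) (hpos : ∀ a, 0 < u a → a ∈ S) (hneg : ∀ a, u a < 0 → a ∈ S')
    (hu : ∀ k < δ + 1, ∑ a ∈ E, u a * (a : ℝ) ^ k = 0) (a : ℕ) : u a = 0 := by
  have hmom : ∀ k < δ + 1, ∑ a ∈ S, max (u a) 0 * (a : ℝ) ^ k =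
      ∑ a ∈ S', max (-u a) 0 * (a : ℝ) ^ k := by
    intro k hk
    have h1 : ∑ a ∈ S, max (u a) 0 * (a : ℝ) ^ k = ∑ a ∈ E, max (u a) 0 * (a : ℝ) ^ k := by
      refine Finset.sum_congr_of_eq_on_inter (fun b _ hb => ?_) (fun b _ hb => ?_)
        fun _ _ _ => rfl
      · rw [not_imp_comm.1 (hE b) hb]; simp
      · rw [max_eq_right (not_lt.1 (mt (hpos b) hb)), zero_mul]
    have h2 : ∑ a ∈ S', max (-u a) 0 * (a : ℝ) ^ k =
        ∑ a ∈ E, max (-u a) 0 * (a : ℝ) ^ k := by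
      refine Finset.sum_congr_of_eq_on_inter (fun b _ hb => ?_) (fun b _ hb => ?_)
        fun _ _ _ => rfl
      · rw [not_imp_comm.1 (hE b) hb]; simp
      · rw [max_eq_right (by linarith [not_lt.1 (mt (hneg b) hb)]), zero_mul]
    rw [h1, h2, ← sub_eq_zero, ← Finset.sum_sub_distrib]
    refine Eq.trans ?_ (hu k hk)
    refine Finset.sum_congr rfl fun b _ => ?_
    rw [← sub_mul, max_zero_sub_max_neg_zero_eq_self]
  have hc0 : 0 ≤ ∑ a ∈ S, max (u a) 0 := Finset.sum_nonneg fun _ _ => le_max_right _ _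
  rcases hc0.eq_or_lt with hc | hc
  · have hc' : ∑ a ∈ S', max (-u a) 0 = 0 := by
      have := hmom 0 (by omega)
      simp only [pow_zero, mul_one] at this
      rw [← this, ← hc]
    have h1 := (Finset.sum_eq_zero_iff_of_nonneg fun _ _ => le_max_right _ _).1 hc.symm
    have h2 := (Finset.sum_eq_zero_iff_of_nonneg fun _ _ => le_max_right _ _).1 hc'
    rcases lt_trichotomy (u a) 0 with h | h | h
    · have := h2 a (hneg a h)
      rw [max_eq_left (by linarith)] at this
      linarith
    · exact h
    · have := h1 a (hpos a h)
      rwa [max_eq_left h.le] at this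
  · set c := ∑ a ∈ S, max (u a) 0 with hcdef
    have h := hT.barycentric_unique hS hS' (w := fun a => max (u a) 0 / c)
      (w' := fun a => max (-u a) 0 / c) (fun _ _ => by positivity) (fun _ _ => by positivity)
      (by rw [← Finset.sum_div, ← hcdef, div_self hc.ne'])
      (fun k hk => by
        simp only [div_mul_eq_mul_div, ← Finset.sum_div]
        rw [hmom k hk]) a
    rcases lt_trichotomy (u a) 0 with h0 | h0 | h0
    · rw [if_pos (hneg a h0), max_eq_right h0.le, max_eq_left (by linarith)] at h
      simp only [zero_div, ite_self] at h
      have := div_pos (neg_pos.2 h0) hc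
      linarith
    · exact h0
    · rw [if_pos (hpos a h0), max_eq_left h0.le, max_eq_right (by linarith)] at h
      simp only [zero_div, ite_self] at h
      have := div_pos h0 hc
      linarith

/-- If every `d`-face of the simplex `S'` is a `d`-face of the triangulation `T`, and `S` is a
simplex of `T`, then a signed measure with vanishing moments of order `≤ 2 * d + 1`, positive
part on `S` and negative part on `S'` has nonpositive moment of order `2 * d + 2`. -/
lemma IsTriangulation.moment_nonpos {m d : ℕ} {T : Finset (Finset ℕ)}
    (hT : IsTriangulation m (2 * d + 1) T) {S S' E : Finset ℕ} (hS : S ∈ T)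
    (hS'c : S'.card = 2 * d + 2) (hface : ∀ A ⊆ S', A.card = d + 1 → IsFace T A) (u : ℕ → ℝ)
    (hE : ∀ a, u a ≠ 0 → a ∈ E) (hpos : ∀ a, 0 < u a → a ∈ S) (hneg : ∀ a, u a < 0 → a ∈ S')
    (hu : ∀ k < 2 * d + 2, ∑ a ∈ E, u a * (a : ℝ) ^ k = 0) :
    ∑ a ∈ E, u a * (a : ℝ) ^ (2 * d + 2) ≤ 0 := by
  induction hN : (E.filter fun a => u a ≠ 0).card using Nat.strong_induction_on
    generalizing u with
  | _ N ih =>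
  have hScard := (hT.1 S hS).2
  by_cases hP : (E.filter fun a => 0 < u a).card ≤ d + 1
  · obtain ⟨A, hPA, -, hA⟩ := Finset.exists_subsuperset_card_eq
      (fun a ha => hpos a (Finset.mem_filter.1 ha).2) hP (by omega)
    have h2 : 2 * A.card = 2 * d + 2 := by omega
    rw [← h2, ← sum_mul_prod_sq_eq A (by rwa [h2])]
    refine Finset.sum_nonpos fun a ha => ?_
    by_cases h0 : 0 < u a
    · rw [Finset.prod_eq_zero (hPA (Finset.mem_filter.2 ⟨ha, h0⟩)) (by simp), mul_zero]
    · exact mul_nonpos_of_nonpos_of_nonneg (not_lt.1 h0)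
        (Finset.prod_nonneg fun _ _ => sq_nonneg _)
  by_cases hM : (E.filter fun a => u a < 0).card ≤ d + 1
  · obtain ⟨A, hMA, hAS', hA⟩ := Finset.exists_subsuperset_card_eq
      (fun a ha => hneg a (Finset.mem_filter.1 ha).2) hM (by omega)
    obtain ⟨S'', hS'', hAS''⟩ := hface A hAS' hA
    have h0 := hT.eq_zero_of_moments_eq_zero hS hS'' hE hpos
      (fun a ha => hAS'' (hMA (Finset.mem_filter.2 ⟨hE a ha.ne, ha⟩))) hu
    simp [h0]
  have hcard : 2 * d + 4 ≤ (E.filter fun a => u a ≠ 0).card := by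
    have hdisj : Disjoint (E.filter fun a => 0 < u a) (E.filter fun a => u a < 0) :=
      Finset.disjoint_filter.2 fun a _ h => h.not_gt
    have hsub : (E.filter fun a => 0 < u a) ∪ (E.filter fun a => u a < 0) ⊆
        E.filter fun a => u a ≠ 0 := by
      intro a ha
      simp only [Finset.mem_union, Finset.mem_filter] at ha ⊢
      rcases ha with ha | ha
      exacts [⟨ha.1, ha.2.ne'⟩, ⟨ha.1, ha.2.ne⟩]
    have := Finset.card_le_card hsub
    rw [Finset.card_union_of_disjoint hdisj] at this
    omega
  obtain ⟨e, he⟩ : (E.filter fun a => u a ≠ 0).Nonempty := Finset.card_pos.1 (by omega)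
  obtain ⟨z, hz0, ⟨b, hb, hzb⟩, hz⟩ := exists_moments_eq_zero (n := 2 * d + 2)
    (F := (E.filter fun a => u a ≠ 0).erase e) (by rw [Finset.card_erase_of_mem he]; omega)
  have hzu : ∀ a, z a ≠ 0 → a ≠ e ∧ a ∈ E ∧ u a ≠ 0 := by
    intro a ha
    simpa using not_imp_comm.1 (hz0 a) ha
  have hzE : ∀ k < 2 * d + 2, ∑ a ∈ E, z a * (a : ℝ) ^ k = 0 := by
    intro k hk
    rw [← hz k hk]
    refine (Finset.sum_subset (fun a ha => (Finset.mem_filter.1 (Finset.mem_of_mem_erase ha)).1)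
      fun a _ ha => ?_).symm
    rw [hz0 a ha, zero_mul]
  -- moving along a dependency of nonpositive top moment reduces the support
  have step : ∀ y : ℕ → ℝ, (∀ a, y a ≠ 0 → u a ≠ 0) →
      (∀ k < 2 * d + 2, ∑ a ∈ E, y a * (a : ℝ) ^ k = 0) → (∃ a, 0 < y a * u a) →
      ∑ a ∈ E, y a * (a : ℝ) ^ (2 * d + 2) ≤ 0 →
      ∑ a ∈ E, u a * (a : ℝ) ^ (2 * d + 2) ≤ 0 := by
    intro y hyu hy hex hytop
    obtain ⟨t, ht, htpos, htneg, a, hua, hta⟩ := exists_conformal_sub hE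
      (fun a => not_imp_not.1 (hyu a)) hex
    have hlin : ∀ k, ∑ a ∈ E, (u a - t * y a) * (a : ℝ) ^ k =
        ∑ a ∈ E, u a * (a : ℝ) ^ k - t * ∑ a ∈ E, y a * (a : ℝ) ^ k := by
      intro k
      rw [Finset.mul_sum, ← Finset.sum_sub_distrib]
      exact Finset.sum_congr rfl fun _ _ => by ring
    have hsupp : ∀ a, u a - t * y a ≠ 0 → u a ≠ 0 := fun a h => by
      rcases lt_or_gt_of_ne h with h | h
      exacts [(htneg a h).ne, (htpos a h).ne']
    have hlt : (E.filter fun a => u a - t * y a ≠ 0) ⊂ E.filter fun a => u a ≠ 0 := by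
      refine (Finset.ssubset_iff_of_subset fun a ha => ?_).2 ⟨a, ?_, ?_⟩
      · rw [Finset.mem_filter] at ha ⊢
        exact ⟨ha.1, hsupp a ha.2⟩
      · exact Finset.mem_filter.2 ⟨hE a hua, hua⟩
      · simp [hta]
    have h := ih _ (hN ▸ Finset.card_lt_card hlt) (fun a => u a - t * y a)
      (fun a h => hE a (hsupp a h)) (fun a h => hpos a (htpos a h))
      (fun a h => hneg a (htneg a h))
      (fun k hk => by rw [hlin, hu k hk, hy k hk, mul_zero, sub_zero]) rfl
    rw [hlin] at h
    have := mul_nonpos_of_nonneg_of_nonpos ht hytop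
    linarith
  -- a dependency which is conformal to `u` has nonpositive top moment
  have conf : ∀ y : ℕ → ℝ, (∀ a, y a ≠ 0 → a ≠ e ∧ a ∈ E ∧ u a ≠ 0) →
      (∀ k < 2 * d + 2, ∑ a ∈ E, y a * (a : ℝ) ^ k = 0) → (∀ a, 0 ≤ y a * u a) →
      ∑ a ∈ E, y a * (a : ℝ) ^ (2 * d + 2) ≤ 0 := by
    intro y hyu hy hc
    refine ih _ (hN ▸ Finset.card_lt_card ?_) y (fun a h => (hyu a h).2.1)
      (fun a h => hpos a (lt_of_le_of_ne (nonneg_of_mul_nonneg_right (hc a) h)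
        (hyu a h.ne').2.2.symm))
      (fun a h => hneg a (lt_of_le_of_ne (nonpos_of_mul_nonneg_right (hc a) h)
        (hyu a h.ne).2.2)) hy rfl
    refine (Finset.ssubset_iff_of_subset fun a ha => ?_).2 ⟨e, he, ?_⟩
    · rw [Finset.mem_filter] at ha ⊢
      exact ⟨ha.1, (hyu a ha.2).2.2⟩
    · exact fun h => (hyu e (Finset.mem_filter.1 h).2).1 rfl
  have main : ∀ y : ℕ → ℝ, (∀ a, y a ≠ 0 → a ≠ e ∧ a ∈ E ∧ u a ≠ 0) → (∃ b, y b ≠ 0) →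
      (∀ k < 2 * d + 2, ∑ a ∈ E, y a * (a : ℝ) ^ k = 0) →
      ∑ a ∈ E, y a * (a : ℝ) ^ (2 * d + 2) ≤ 0 →
      ∑ a ∈ E, u a * (a : ℝ) ^ (2 * d + 2) ≤ 0 := by
    intro y hyu hb hy htop
    by_cases hex : ∃ a, 0 < y a * u a
    · exact step y (fun a h => (hyu a h).2.2) hy hex htop
    push Not at hex
    have hy' : ∀ k < 2 * d + 2, ∑ a ∈ E, (-y a) * (a : ℝ) ^ k = 0 := by
      intro k hk
      simp [hy k hk]
    have hyu' : ∀ a, -y a ≠ 0 → a ≠ e ∧ a ∈ E ∧ u a ≠ 0 := fun a h => hyu a (neg_ne_zero.1 h)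
    obtain ⟨b, hb⟩ := hb
    refine step (fun a => -y a) (fun a h => (hyu' a h).2.2) hy' ⟨b, ?_⟩
      (conf _ hyu' hy' fun a => by linarith [hex a])
    have := lt_of_le_of_ne (hex b) (mul_ne_zero hb (hyu b hb).2.2)
    linarith
  rcases le_total (∑ a ∈ E, z a * (a : ℝ) ^ (2 * d + 2)) 0 with h | h
  · exact main z hzu ⟨b, hzb⟩ hzE h
  · refine main (fun a => -z a) (fun a h => hzu a (neg_ne_zero.1 h)) ⟨b, neg_ne_zero.2 hzb⟩
      (fun k hk => by simp [hzE k hk]) ?_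
    simpa using h

/-- The last coordinate of a lift is a moment of the barycentric coordinates. -/
lemma lastCoord_sum_smul_momCurve {δ : ℕ} (S : Finset ℕ) (w : ℕ → ℝ) :
    lastCoord (∑ a ∈ S, w a • momCurve (δ + 1) (a : ℝ)) = ∑ a ∈ S, w a * (a : ℝ) ^ (δ + 1) := by
  simp [lastCoord, momCurve, Finset.sum_apply]


/-- for triangulations of `C(m, 2d+1)`, `T ≤₂ T'` iff every `d`-face of
`T'` is a `d`-face of `T`. -/
theorem statement16 (d m : ℕ) (hd : 1 ≤ d) (hm : 2 * d + 2 ≤ m)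
    (T T' : Finset (Finset ℕ))
    (hT : IsTriangulation m (2 * d + 1) T) (hT' : IsTriangulation m (2 * d + 1) T') :
    HST2 (2 * d + 1) T T' ↔
      ∀ A : Finset ℕ, A.card = d + 1 → IsFace T' A → IsFace T A := by
  constructor
  · intro h A hA hAface
    obtain ⟨S', hS', hAS'⟩ := hAface
    have hA0 : (0 : ℝ) < A.card := by rw [hA]; positivity
    have hw1 : ∑ a ∈ S', (if a ∈ A then (A.card : ℝ)⁻¹ else 0) = 1 := by
      rw [Finset.sum_ite_mem, Finset.inter_eq_right.2 hAS', Finset.sum_const, nsmul_eq_mul,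
        mul_inv_cancel₀ hA0.ne']
    set w' : ℕ → ℝ := fun a => if a ∈ A then (A.card : ℝ)⁻¹ else 0 with hw'def
    have hw' : ∀ a ∈ S', 0 ≤ w' a := fun a _ => by simp only [hw'def]; positivity
    have hxS' : (∑ a ∈ S', w' a • momCurve (2 * d + 1) (a : ℝ)) ∈ smp (2 * d + 1) S' :=
      mem_smp_iff.2 ⟨w', hw', hw1, rfl⟩
    have hxc := smp_mono (hT'.1 S' hS').1 hxS'
    change _ ∈ cyc m (2 * d + 1) at hxc
    rw [← hT.2.1] at hxc
    obtain ⟨S, hS, hxS⟩ := Set.mem_iUnion₂.1 hxc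
    obtain ⟨w, hw, hw1', hwx⟩ := mem_smp_iff.1 hxS
    have hle := h S hS S' hS' _ ⟨hxS, hxS'⟩ _ _ ⟨w, hw, hw1', hwx, rfl⟩
      ⟨w', hw', hw1, rfl, rfl⟩
    rw [lastCoord_sum_smul_momCurve, lastCoord_sum_smul_momCurve] at hle
    have hmom := sum_smul_momCurve_eq_iff.1 ⟨hw1'.trans hw1.symm, hwx⟩
    have h2 : 2 * A.card = 2 * d + 1 + 1 := by omega
    have hq := sum_mul_prod_sq_eq (E := S ∪ S')
      (u := fun a => (if a ∈ S then w a else 0) - if a ∈ S' then w' a else 0) A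
      (fun k hk => by rw [sum_sub_ite_mul, hmom k (by omega), sub_self])
    rw [sum_sub_ite_mul S S' w w' fun a => ∏ b ∈ A, ((a : ℝ) - b) ^ 2,
      sum_sub_ite_mul S S' w w' fun a => (a : ℝ) ^ (2 * A.card), h2] at hq
    have hzero : ∑ a ∈ S', w' a * ∏ b ∈ A, ((a : ℝ) - b) ^ 2 = 0 := by
      refine Finset.sum_eq_zero fun a _ => ?_
      by_cases ha : a ∈ A
      · rw [Finset.prod_eq_zero ha (by simp), mul_zero]
      · simp [hw'def, ha]
    have hnn : ∀ a ∈ S, 0 ≤ w a * ∏ b ∈ A, ((a : ℝ) - b) ^ 2 := fun a ha =>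
      mul_nonneg (hw a ha) (Finset.prod_nonneg fun _ _ => sq_nonneg _)
    have hall := (Finset.sum_eq_zero_iff_of_nonneg hnn).1
      (le_antisymm (by linarith) (Finset.sum_nonneg hnn))
    have hsupp : ∀ a ∈ S, w a ≠ 0 → a ∈ A := by
      intro a ha hwa
      obtain ⟨b, hb, hab⟩ := Finset.prod_eq_zero_iff.1
        ((mul_eq_zero.1 (hall a ha)).resolve_left hwa)
      have : a = b := by exact_mod_cast sub_eq_zero.1 (pow_eq_zero_iff two_ne_zero |>.1 hab)
      exact this ▸ hb
    refine ⟨S, hS, fun a ha => ?_⟩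
    by_contra haS
    have h0 := eq_zero_of_moments_eq_zero (E := S ∪ S') (n := 2 * d + 1 + 1) (F := A)
      (u := fun a => (if a ∈ S then w a else 0) - if a ∈ S' then w' a else 0)
      (fun k hk => by rw [sum_sub_ite_mul, hmom k hk, sub_self]) (by omega)
      (fun b _ hb => by
        by_contra hbA
        apply hb
        have h1 : w' b = 0 := by simp [hw'def, hbA]
        have h2 : b ∈ S → w b = 0 := fun hbS => by
          by_contra hne
          exact hbA (hsupp b hbS hne)
        by_cases hbS : b ∈ S
        · simp [h1, h2 hbS]
        · simp [h1, hbS]) a (Finset.mem_union_right _ (hAS' ha))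
    simp only [if_neg haS, if_pos (hAS' ha), hw'def, if_pos ha] at h0
    have := inv_pos.2 hA0
    linarith
  · rintro h S hS S' hS' x - y y' ⟨w, hw, hw1, hwx, rfl⟩ ⟨w', hw', hw1', hwx', rfl⟩
    rw [lastCoord_sum_smul_momCurve, lastCoord_sum_smul_momCurve]
    have hmom := sum_smul_momCurve_eq_iff.1 ⟨hw1.trans hw1'.symm, hwx.trans hwx'.symm⟩
    have key := hT.moment_nonpos (E := S ∪ S') hS (hT'.1 S' hS').2
      (fun A hA hAc => h A hAc ⟨S', hS', hA⟩)
      (fun a => (if a ∈ S then w a else 0) - if a ∈ S' then w' a else 0)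
      (fun a ha => by
        by_contra hn
        rw [Finset.mem_union, not_or] at hn
        simp [hn.1, hn.2] at ha)
      (fun a ha => by
        by_contra hn
        by_cases hS'a : a ∈ S'
        · simp only [if_neg hn, if_pos hS'a] at ha
          linarith [hw' a hS'a]
        · simp [hn, hS'a] at ha)
      (fun a ha => by
        by_contra hn
        by_cases hSa : a ∈ S
        · simp only [if_neg hn, if_pos hSa] at ha
          linarith [hw a hSa]
        · simp [hn, hSa] at ha)
      (fun k hk => by rw [sum_sub_ite_mul, hmom k hk, sub_self])
    rw [sum_sub_ite_mul] at key
    exact sub_nonpos.1 key
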